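/- Suppose condition (HP1) holds. Then there exists a constant C′ > 0, depending only on p, σ and the constants C, C₀, R₀, ε₀ appearing in (HP1), such that every stable weak solution u of −Δ_p u = V|u|^{σ−1}u on ℝ^m satisfies ∫_{ℝ^m} V|u|^{σ+γ̄} dx ≤ C′; in particular V|u|^{σ+γ̄} is integrable on ℝ^m. -/

import Mathlib

open MeasureTheory Real Set Metric Filter
open scoped ENNReal NNReal RealInnerProductSpace

noncomputable section

/-- Euclidean space `ℝ^m`. -/
abbrev Em (m : ℕ) := EuclideanSpace ℝ (Fin m)

/-- A Lipschitz function with compact support. -/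
def LipCS {m : ℕ} (φ : Em m → ℝ) : Prop :=
  (∃ L : ℝ≥0, LipschitzWith L φ) ∧ HasCompactSupport φ

/-- `u` is a weak solution of `-Δ_p u = V |u|^(σ-1) u` on `ℝ^m`:
`u` is `C¹`, `|∇u|^p` and `V |u|^(σ+1)` are locally integrable, and the weak
formulation holds against every Lipschitz test function with compact support. -/
def IsWeakSol {m : ℕ} (p σ : ℝ) (V u : Em m → ℝ) : Prop :=
  ContDiff ℝ 1 u ∧
  LocallyIntegrable (fun x => ‖gradient u x‖ ^ p) volume ∧
  LocallyIntegrable (fun x => V x * |u x| ^ (σ + 1)) volume ∧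
  ∀ φ : Em m → ℝ, LipCS φ →
    (∫ x, ‖gradient u x‖ ^ (p - 2) * ⟪gradient u x, gradient φ x⟫) =
      ∫ x, V x * |u x| ^ (σ - 1) * u x * φ x

/-- Stability of a weak solution `u`. -/
def IsStable {m : ℕ} (p σ : ℝ) (V u : Em m → ℝ) : Prop :=
  ∀ φ : Em m → ℝ, LipCS φ →
    σ * ∫ x, V x * |u x| ^ (σ - 1) * φ x ^ 2 ≤
      (∫ x, ‖gradient u x‖ ^ (p - 2) * ‖gradient φ x‖ ^ 2) +
        (p - 2) * ∫ x, ‖gradient u x‖ ^ (p - 4) * ⟪gradient u x, gradient φ x⟫ ^ 2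

/-- `γ̄ = (2σ - p + 1 + 2√(σ(σ - p + 1)))/(p - 1)`. -/
def gammaBar (p σ : ℝ) : ℝ := (2 * σ - p + 1 + 2 * Real.sqrt (σ * (σ - p + 1))) / (p - 1)

/-- `α = p (σ + γ̄)/(σ - p + 1)`. -/
def alphaC (p σ : ℝ) : ℝ := p * (σ + gammaBar p σ) / (σ - p + 1)

/-- `β = (γ̄ + p - 1)/(σ - p + 1)`. -/
def betaC (p σ : ℝ) : ℝ := (gammaBar p σ + p - 1) / (σ - p + 1)

/-- The critical exponent `σ_c(m, p)`. -/
def sigmaC (mr p : ℝ) : ℝ :=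
  (((p - 1) * mr - p) ^ 2 + p ^ 2 * (p - 2) - p ^ 2 * (p - 1) * mr +
      2 * p ^ 2 * Real.sqrt ((p - 1) * (mr - 1))) /
    ((mr - p) * ((p - 1) * mr - p * (p + 3)))

/-- Condition (HP1). -/
def HP1 {m : ℕ} (p σ : ℝ) (V : Em m → ℝ) : Prop :=
  ∃ C C₀ R₀ ε₀ : ℝ, 0 < C ∧ 0 < C₀ ∧ 0 < R₀ ∧ 0 < ε₀ ∧
    ∀ ε ∈ Set.Ioo (0 : ℝ) ε₀, ∀ R > R₀,
      (∫⁻ x in Metric.ball (0 : Em m) R \ Metric.ball (0 : Em m) (R / 2),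
          ENNReal.ofReal (V x ^ (-(betaC p σ) + ε))) ≤
        ENNReal.ofReal (C * R ^ (alphaC p σ + C₀ * ε) * (Real.log R)⁻¹)

/-- Condition (HP2). -/
def HP2 {m : ℕ} (p σ : ℝ) (V : Em m → ℝ) : Prop :=
  ∃ C C₀ R₀ ε₀ θ b : ℝ, 0 < C ∧ 0 < C₀ ∧ 0 < R₀ ∧ 0 < ε₀ ∧ 0 < θ ∧
    b < -1 + θ / (σ - p + 1) ∧
    ∀ ε ∈ Set.Ioo (0 : ℝ) ε₀, ∀ R > R₀,
      (∫⁻ x in Metric.ball (0 : Em m) R \ Metric.ball (0 : Em m) (R / 2),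
          ENNReal.ofReal (V x ^ (-(betaC p σ) + ε))) ≤
        ENNReal.ofReal (C * R ^ (alphaC p σ + C₀ * ε) * Real.log R ^ b *
          Real.exp (-θ * ε * Real.log (R / 2) * Real.log (Real.log (R / 2))))

/-! ### Algebra of the exponents -/

lemma gammaBar_quadratic {p σ : ℝ} (hp : 2 ≤ p) (hσ : p - 1 < σ) :
    (p - 1) * (gammaBar p σ + 1) ^ 2 = 4 * σ * gammaBar p σ := by
  have h1 : p - 1 ≠ 0 := by linarith
  have hs : Real.sqrt (σ * (σ - p + 1)) ^ 2 = σ * (σ - p + 1) :=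
    Real.sq_sqrt (mul_nonneg (by linarith) (by linarith))
  unfold gammaBar
  set s := Real.sqrt (σ * (σ - p + 1))
  field_simp
  linear_combination 4 * hs

lemma one_lt_gammaBar {p σ : ℝ} (hp : 2 ≤ p) (hσ : p - 1 < σ) : 1 < gammaBar p σ := by
  unfold gammaBar
  rw [one_lt_div (by linarith)]
  have := Real.sqrt_nonneg (σ * (σ - p + 1))
  linarith

/-! ### Young-type inequalities -/

lemma rpow_mul_le_add {p X Y η : ℝ} (hp : 2 ≤ p) (hX : 0 ≤ X) (hY : 0 ≤ Y) (hη : 0 < η) :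
    X ^ (p - 1) * Y ≤ η * X ^ p + η ^ (1 - p) * Y ^ p := by
  have e : ∀ Z : ℝ, 0 ≤ Z → Z ^ p = Z ^ (p - 1) * Z := fun Z hZ => by
    conv_rhs => rw [← Real.rpow_one Z, ← Real.rpow_mul hZ, one_mul]
    rw [← Real.rpow_add' hZ (by linarith)]; ring_nf
  rcases le_or_gt Y (η * X) with h | h
  · have : X ^ (p - 1) * Y ≤ X ^ (p - 1) * (η * X) := by gcongr
    have h2 : 0 ≤ η ^ (1 - p) * Y ^ p := by positivity
    rw [e X hX]; linarith
  · have hXY : X ≤ Y / η := by rw [le_div_iff₀ hη]; linarith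
    have : X ^ (p - 1) * Y ≤ (Y / η) ^ (p - 1) * Y := by
      gcongr; linarith
    rw [Real.div_rpow hY hη.le, div_eq_mul_inv, ← Real.rpow_neg hη.le, neg_sub] at this
    have h2 : 0 ≤ η * X ^ p := by positivity
    rw [e Y hY]; linarith

lemma rpow_mul_sq_le_add {p X Y η : ℝ} (hp : 2 ≤ p) (hX : 0 ≤ X) (hY : 0 ≤ Y) (hη : 0 < η)
    (hη1 : η ≤ 1) :
    X ^ (p - 2) * Y ^ 2 ≤ η * X ^ p + η ^ (1 - p) * Y ^ p := by
  have e : ∀ Z : ℝ, 0 ≤ Z → Z ^ p = Z ^ (p - 2) * Z ^ 2 := fun Z hZ => by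
    rw [← Real.rpow_natCast Z, ← Real.rpow_add' hZ (by norm_num; linarith)]
    norm_num
  rcases le_or_gt Y (η * X) with h | h
  · have : X ^ (p - 2) * Y ^ 2 ≤ X ^ (p - 2) * (η * X) ^ 2 := by gcongr
    have h3 : η ^ 2 * X ^ p ≤ η * X ^ p := by
      gcongr; nlinarith
    have h2 : 0 ≤ η ^ (1 - p) * Y ^ p := by positivity
    rw [e X hX] at *; linarith
  · have hXY : X ≤ Y / η := by rw [le_div_iff₀ hη]; linarith
    have : X ^ (p - 2) * Y ^ 2 ≤ (Y / η) ^ (p - 2) * Y ^ 2 := by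
      gcongr
    rw [Real.div_rpow hY hη.le, div_eq_mul_inv, ← Real.rpow_neg hη.le, neg_sub] at this
    have h4 : η ^ (2 - p) * Y ^ p ≤ η ^ (1 - p) * Y ^ p := by
      gcongr ?_ * _
      exact Real.rpow_le_rpow_of_exponent_ge hη hη1 (by linarith)
    have h2 : 0 ≤ η * X ^ p := by positivity
    rw [e Y hY] at *; linarith

/-- Weighted Young inequality with exponents `(σ + γ)/(γ + p - 1)` and its conjugate. -/
lemma rpow_mul_le_weighted {p σ γ q w t z v κ : ℝ} (hp : 2 ≤ p) (hσ : p - 1 < σ) (hγ : 1 < γ)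
    (hq : p * (σ + γ) / (σ - p + 1) ≤ q) (hw : 0 ≤ w) (ht : 0 ≤ t) (ht1 : t ≤ 1) (hz : 0 ≤ z)
    (hv : 0 < v) (hκ : 0 < κ) :
    w ^ (γ + p - 1) * t ^ (q - p) * z ^ p ≤
      κ * (v * w ^ (σ + γ) * t ^ q) +
        κ ^ (-((γ + p - 1) / (σ - p + 1))) *
          (v ^ (-((γ + p - 1) / (σ - p + 1))) * z ^ (p * (σ + γ) / (σ - p + 1))) := by
  have hd : 0 < σ - p + 1 := by linarith
  have hb : 0 < γ + p - 1 := by linarith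
  set β := (γ + p - 1) / (σ - p + 1) with hβ
  have hβ0 : 0 < β := by positivity
  have hα : p * (σ + γ) / (σ - p + 1) = p + p * β := by rw [hβ]; field_simp; ring
  rw [hα] at hq ⊢
  have hqp : p * β ≤ q - p := by linarith
  have hpβ : 0 < p * β := by positivity
  rcases le_or_gt (z ^ p) (κ * v * w ^ (σ - p + 1) * t ^ p) with h | h
  · have h1 : w ^ (γ + p - 1) * t ^ (q - p) * z ^ p ≤
        w ^ (γ + p - 1) * t ^ (q - p) * (κ * v * w ^ (σ - p + 1) * t ^ p) := by gcongr
    have e1 : w ^ (γ + p - 1) * w ^ (σ - p + 1) = w ^ (σ + γ) := by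
      rw [← Real.rpow_add' hw (by linarith)]; ring_nf
    have e2 : t ^ (q - p) * t ^ p = t ^ q := by
      rw [← Real.rpow_add' ht (by linarith)]; ring_nf
    have h2 : 0 ≤ κ ^ (-β) * (v ^ (-β) * z ^ (p + p * β)) := by positivity
    calc _ ≤ _ := h1
      _ = κ * (v * (w ^ (γ + p - 1) * w ^ (σ - p + 1)) * (t ^ (q - p) * t ^ p)) := by ring
      _ ≤ _ := by rw [e1, e2]; linarith
  · have h0 : w ^ (σ - p + 1) * t ^ p ≤ z ^ p * (κ * v)⁻¹ := by
      rw [← div_eq_mul_inv, le_div_iff₀ (by positivity)]; linarith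
    have h1 := Real.rpow_le_rpow (by positivity) h0 hβ0.le
    rw [Real.mul_rpow (by positivity) (by positivity), ← Real.rpow_mul hw, ← Real.rpow_mul ht,
      Real.mul_rpow (by positivity) (by positivity), ← Real.rpow_mul hz,
      Real.inv_rpow (by positivity), ← Real.rpow_neg (by positivity),
      Real.mul_rpow hκ.le hv.le] at h1
    have e1 : (σ - p + 1) * β = γ + p - 1 := by rw [hβ]; field_simp
    rw [e1] at h1
    have h2 : t ^ (q - p) ≤ t ^ (p * β) :=
      Real.rpow_le_rpow_of_exponent_ge' ht ht1 hpβ.le hqp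
    have e3 : z ^ (p + p * β) = z ^ (p * β) * z ^ p := by
      rw [← Real.rpow_add' hz (by linarith)]; ring_nf
    have h3 : 0 ≤ κ * (v * w ^ (σ + γ) * t ^ q) := by positivity
    calc w ^ (γ + p - 1) * t ^ (q - p) * z ^ p ≤ w ^ (γ + p - 1) * t ^ (p * β) * z ^ p := by gcongr
      _ ≤ z ^ (p * β) * (κ ^ (-β) * v ^ (-β)) * z ^ p := by gcongr
      _ ≤ _ := by rw [e3]; linarith

/-! ### Absorption of the error terms -/

lemma stability_gap {p σ δ : ℝ} (hp : 2 ≤ p) (hσ : p - 1 < σ) (hδ : 0 < δ)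
    (hδ1 : δ < gammaBar p σ - 1) :
    (p - 1) * (1 - 1 / gammaBar p σ) / (4 * gammaBar p σ) * δ ≤
      σ - (p - 1) * (gammaBar p σ - δ + 1) ^ 2 / (4 * (gammaBar p σ - δ)) := by
  have hq := gammaBar_quadratic hp hσ
  have hg := one_lt_gammaBar hp hσ
  set Γ := gammaBar p σ
  obtain ⟨γ, hγ⟩ : ∃ γ, γ = Γ - δ := ⟨_, rfl⟩
  rw [← hγ]
  have hγ1 : 1 < γ := by linarith
  have hδe : δ = Γ - γ := by linarith
  have hσe : σ = (p - 1) * (Γ + 1) ^ 2 / (4 * Γ) := by field_simp; linarith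
  have e : σ - (p - 1) * (γ + 1) ^ 2 / (4 * γ) =
      (p - 1) * (γ - 1 / Γ) / (4 * γ) * δ := by
    rw [hσe, hδe]; field_simp; ring
  rw [e]
  have hG : 1 / Γ < 1 := by rw [div_lt_one (by linarith)]; exact hg
  have hp1 : 0 ≤ p - 1 := by linarith
  have h1 : 0 ≤ 1 - 1 / Γ := by linarith
  gcongr
  all_goals nlinarith

lemma absorb_error_terms {p σ : ℝ} (hp : 2 ≤ p) (hσ : p - 1 < σ) {k : ℝ} (hk : 1 ≤ k) :
    ∃ K > (0 : ℝ), ∃ δ₁ > (0 : ℝ), δ₁ ≤ 1 ∧ δ₁ ≤ gammaBar p σ - 1 ∧ ∀ δ : ℝ, 0 < δ → δ < δ₁ →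
      ∀ A B D₁ D₂ F : ℝ, 0 ≤ A → 0 ≤ B → 0 ≤ D₁ → 0 ≤ D₂ → 0 ≤ F →
        (gammaBar p σ - δ) * A ≤ B + 2 * k * D₁ →
        σ * B ≤ (p - 1) * ((gammaBar p σ - δ + 1) ^ 2 / 4 * A +
          (gammaBar p σ - δ + 1) * k * D₁ + k ^ 2 * D₂) →
        (∀ η : ℝ, 0 < η → η ≤ 1 → D₁ ≤ η * A + η ^ (1 - p) * F) →
        (∀ η : ℝ, 0 < η → η ≤ 1 → D₂ ≤ η * A + η ^ (1 - p) * F) →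
        B ≤ K * (δ ^ (-p) * F) := by
  have hg := one_lt_gammaBar hp hσ
  have hgap := @stability_gap p σ
  set Γ := gammaBar p σ
  set c := (p - 1) * (1 - 1 / Γ) / (4 * Γ) with hc
  have hc0 : 0 < c := by
    have : 1 / Γ < 1 := by rw [div_lt_one (by linarith)]; exact hg
    exact div_pos (mul_pos (by linarith) (by linarith)) (by linarith)
  set M := (p - 1) * ((Γ + 1) ^ 2 * k + (Γ + 1) * k + k ^ 2) with hM
  have hM0 : 0 < M := mul_pos (by linarith) (by positivity)
  set M' := 4 * k * (1 / (4 * k)) ^ (1 - p) with hM'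
  have hM'0 : 0 < M' := by positivity
  refine ⟨4 * M * (M' + 1) * (c / (8 * M)) ^ (1 - p) / c, by positivity,
    min 1 (min (Γ - 1) (8 * M / c)), lt_min one_pos (lt_min (by linarith) (by positivity)),
    min_le_left _ _, (min_le_right _ _).trans (min_le_left _ _), ?_⟩
  intro δ hδ hδ1 A B D₁ D₂ F hA hB hD₁ hD₂ hF h1 h2 hY₁ hY₂
  have hδΓ : δ < Γ - 1 := hδ1.trans_le ((min_le_right _ _).trans (min_le_left _ _))
  have hδM : δ < 8 * M / c := hδ1.trans_le ((min_le_right _ _).trans (min_le_right _ _))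
  have hgap := hgap hp hσ hδ hδΓ
  obtain ⟨γ, hγ⟩ : ∃ γ, γ = Γ - δ := ⟨_, rfl⟩
  rw [← hγ] at h1 h2 hgap
  have hγ1 : 1 < γ := by linarith
  have hγΓ : γ ≤ Γ := by linarith
  -- bound of the gradient term
  have hAB : A ≤ 2 * B + M' * F := by
    have h4k : 1 / (4 * k) ≤ 1 := by rw [div_le_one (by positivity)]; linarith
    have := hY₁ (1 / (4 * k)) (by positivity) h4k
    have h5 : 2 * k * D₁ ≤ A / 2 + M' / 2 * F := by
      calc 2 * k * D₁ ≤ 2 * k * (1 / (4 * k) * A + (1 / (4 * k)) ^ (1 - p) * F) := by gcongr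
        _ = _ := by rw [hM']; field_simp; ring
    nlinarith
  have hmain : c * δ * B ≤ M * (D₁ + D₂) := by
    have h6 : (p - 1) * (γ + 1) ^ 2 / (4 * γ) * (γ * A) ≤
        (p - 1) * (γ + 1) ^ 2 / (4 * γ) * (B + 2 * k * D₁) := by
      have hp1 : 0 ≤ p - 1 := by linarith
      gcongr
    have e6 : (p - 1) * (γ + 1) ^ 2 / (4 * γ) * (γ * A) = (p - 1) * ((γ + 1) ^ 2 / 4 * A) := by
      field_simp
    have h7 : c * δ * B ≤ (σ - (p - 1) * (γ + 1) ^ 2 / (4 * γ)) * B := by gcongr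
    have h8 : (γ + 1) ^ 2 / (4 * γ) * (2 * k) ≤ (Γ + 1) ^ 2 * k := by
      have : (γ + 1) ^ 2 / (4 * γ) * (2 * k) = ((γ + 1) ^ 2 * k) / (2 * γ) := by field_simp; ring
      rw [this, div_le_iff₀ (by positivity)]
      have : (γ + 1) ^ 2 * k ≤ (Γ + 1) ^ 2 * k := by gcongr
      nlinarith [show 0 ≤ (Γ + 1) ^ 2 * k by positivity]
    have hp1 : 0 ≤ p - 1 := by linarith
    have h9 : c * δ * B ≤ (p - 1) * (((γ + 1) ^ 2 / (4 * γ) * (2 * k) + (γ + 1) * k) * D₁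
        + k ^ 2 * D₂) := by
      have e9 : (p - 1) * (γ + 1) ^ 2 / (4 * γ) * (B + 2 * k * D₁) =
        (p - 1) * (γ + 1) ^ 2 / (4 * γ) * B + (p - 1) * ((γ + 1) ^ 2 / (4 * γ) * (2 * k) * D₁) := by
        ring
      rw [e6, e9] at h6
      linarith
    refine h9.trans ?_
    rw [hM, mul_assoc]
    have : ((γ + 1) ^ 2 / (4 * γ) * (2 * k) + (γ + 1) * k) * D₁ + k ^ 2 * D₂ ≤
        ((Γ + 1) ^ 2 * k + (Γ + 1) * k) * D₁ + k ^ 2 * D₂ := by gcongr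
    gcongr
    have t1 : 0 ≤ k ^ 2 * D₁ := by positivity
    have t2 : 0 ≤ ((Γ + 1) ^ 2 * k + (Γ + 1) * k) * D₂ := by positivity
    linarith
  obtain ⟨η, hη⟩ : ∃ η, η = c / (8 * M) * δ := ⟨_, rfl⟩
  have hη0 : 0 < η := by rw [hη]; positivity
  have hη1 : η ≤ 1 := by
    rw [lt_div_iff₀ hc0] at hδM
    rw [hη, div_mul_eq_mul_div, div_le_one (by positivity)]; linarith
  have hDD : D₁ + D₂ ≤ 2 * (η * (2 * B + M' * F) + η ^ (1 - p) * F) := by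
    have : η * A ≤ η * (2 * B + M' * F) := by gcongr
    linarith [hY₁ η hη0 hη1, hY₂ η hη0 hη1]
  have hηp : η ≤ η ^ (1 - p) := by
    conv_lhs => rw [← Real.rpow_one η]
    exact Real.rpow_le_rpow_of_exponent_ge hη0 hη1 (by linarith)
  have h10 : c * δ * B ≤ c * δ * B / 2 + 2 * M * ((M' + 1) * (η ^ (1 - p) * F)) := by
    calc c * δ * B ≤ M * (2 * (η * (2 * B + M' * F) + η ^ (1 - p) * F)) :=
          hmain.trans (by gcongr)
      _ = 4 * M * η * B + 2 * M * (M' * (η * F) + η ^ (1 - p) * F) := by ring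
      _ ≤ 4 * M * η * B + 2 * M * (M' * (η ^ (1 - p) * F) + η ^ (1 - p) * F) := by gcongr
      _ = _ := by rw [show 4 * M * η = c * δ / 2 by rw [hη]; field_simp; ring]; ring
  have e11 : η ^ (1 - p) = (c / (8 * M)) ^ (1 - p) * (δ * δ ^ (-p)) := by
    rw [hη, Real.mul_rpow (by positivity) hδ.le, sub_eq_add_neg, Real.rpow_add hδ, Real.rpow_one]
  rw [e11] at h10
  have h12 : (c * δ) * B ≤
      (c * δ) * (4 * M * (M' + 1) * (c / (8 * M)) ^ (1 - p) / c * (δ ^ (-p) * F)) := by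
    have : (c * δ) * (4 * M * (M' + 1) * (c / (8 * M)) ^ (1 - p) / c * (δ ^ (-p) * F)) =
      2 * (2 * M * ((M' + 1) * ((c / (8 * M)) ^ (1 - p) * (δ * δ ^ (-p)) * F))) := by
      field_simp; ring
    rw [this]; linarith
  exact le_of_mul_le_mul_left h12 (by positivity)

/-! ### Calculus of the test functions -/

lemma hasDerivAt_abs_rpow_mul_self {s : ℝ} (hs : 0 < s) (t : ℝ) :
    HasDerivAt (fun t : ℝ => |t| ^ s * t) ((s + 1) * |t| ^ s) t := by
  rcases eq_or_ne t 0 with rfl | ht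
  · have h0 : Tendsto (fun x : ℝ => |x| ^ s) (nhds 0) (nhds 0) := by
      have : ContinuousAt (fun x : ℝ => |x| ^ s) 0 :=
        continuous_abs.continuousAt.rpow_const (Or.inr hs.le)
      simpa [ContinuousAt, Real.zero_rpow hs.ne'] using this
    rw [hasDerivAt_iff_tendsto_slope]
    have : Tendsto (fun x : ℝ => |x| ^ s) (nhdsWithin 0 {0}ᶜ) (nhds 0) :=
      h0.mono_left nhdsWithin_le_nhds
    simp only [abs_zero, Real.zero_rpow hs.ne', mul_zero]
    refine this.congr' ?_
    filter_upwards [self_mem_nhdsWithin] with x hx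
    have hx : x ≠ 0 := hx
    simp [slope_def_field, hx]
  · have h1 := (((hasDerivAt_abs ht).rpow_const (p := s) (Or.inl (abs_ne_zero.2 ht))).mul
      (hasDerivAt_id t))
    refine h1.congr_deriv ?_
    have e : |t| ^ s = |t| ^ (s - 1) * |t| := by
      conv_lhs => rw [show s = s - 1 + 1 by ring, Real.rpow_add_one (abs_ne_zero.2 ht)]
    have e2 : (SignType.sign t : ℝ) * t = |t| := by exact sign_mul_self t
    simp only [id, mul_one]
    rw [e, ← e2]; ring

lemma contDiff_abs_rpow_mul_self {s : ℝ} (hs : 0 < s) :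
    ContDiff ℝ 1 (fun t : ℝ => |t| ^ s * t) := by
  rw [contDiff_one_iff_deriv]
  refine ⟨fun t => (hasDerivAt_abs_rpow_mul_self hs t).differentiableAt, ?_⟩
  have : deriv (fun t : ℝ => |t| ^ s * t) = fun t => (s + 1) * |t| ^ s :=
    funext fun t => (hasDerivAt_abs_rpow_mul_self hs t).deriv
  rw [this]
  exact continuous_const.mul (continuous_abs.rpow_const fun _ => Or.inr hs.le)

section Euclidean

variable {m : ℕ}

lemma norm_gradient (f : Em m → ℝ) (x : Em m) : ‖gradient f x‖ = ‖fderiv ℝ f x‖ := by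
  rw [gradient, LinearIsometryEquiv.norm_map]

lemma measurable_gradient (f : Em m → ℝ) : Measurable (gradient f) :=
  (InnerProductSpace.toDual ℝ (Em m)).symm.continuous.measurable.comp (measurable_fderiv ℝ f)

lemma continuous_gradient {f : Em m → ℝ} (hf : ContDiff ℝ 1 f) : Continuous (gradient f) :=
  (InnerProductSpace.toDual ℝ (Em m)).symm.continuous.comp (hf.continuous_fderiv (by norm_num))

lemma norm_gradient_le {f : Em m → ℝ} {L : ℝ≥0} (hf : LipschitzWith L f) (x : Em m) :
    ‖gradient f x‖ ≤ L := by
  rw [norm_gradient]; exact norm_fderiv_le_of_lipschitz ℝ hf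

lemma hasCompactSupport_gradient {f : Em m → ℝ} (hf : HasCompactSupport f) :
    HasCompactSupport (gradient f) :=
  (hf.fderiv ℝ).comp_left (map_zero _)

lemma LipCS.mul_contDiff {f ψ : Em m → ℝ} (hf : ContDiff ℝ 1 f) (hψ : LipCS ψ) :
    LipCS (fun x => f x * ψ x) := by
  obtain ⟨⟨L, hL⟩, hc⟩ := hψ
  refine ⟨?_, hc.mul_left⟩
  obtain ⟨ρ, hρ⟩ := hc.isCompact.isBounded.subset_closedBall (0 : Em m)
  have hK : IsCompact (closedBall (0 : Em m) ρ) := isCompact_closedBall _ _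
  obtain ⟨K, hfK⟩ : ∃ K, LipschitzOnWith K f (closedBall (0 : Em m) ρ) :=
    hf.contDiffOn.exists_lipschitzOnWith (by norm_num) (convex_closedBall _ _) hK
  obtain ⟨M, hM⟩ := hK.exists_bound_of_continuousOn hf.continuous.continuousOn
  obtain ⟨N, hN⟩ := hK.exists_bound_of_continuousOn hL.continuous.continuousOn
  have hz : ∀ y, y ∉ closedBall (0 : Em m) ρ → ψ y = 0 := fun y hy => by
    by_contra h
    exact hy (hρ (subset_tsupport _ h))
  have hsub : ∀ x y, |ψ x - ψ y| ≤ L * ‖x - y‖ := fun x y => by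
    simpa [Real.dist_eq, dist_eq_norm] using hL.dist_le_mul x y
  have key : ∀ x ∈ closedBall (0 : Em m) ρ, ∀ y,
      |f x * ψ x - f y * ψ y| ≤ (|M| * L + K * |N|) * ‖x - y‖ := by
    intro x hx y
    have h1 : |f x| ≤ |M| := (hM x hx).trans (le_abs_self M)
    have h2 : |f x| * |ψ x - ψ y| ≤ |M| * (L * ‖x - y‖) :=
      mul_le_mul h1 (hsub x y) (abs_nonneg _) (abs_nonneg _)
    by_cases hy : y ∈ closedBall (0 : Em m) ρ
    · have h3 : |f x - f y| ≤ K * ‖x - y‖ := by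
        simpa [Real.dist_eq, dist_eq_norm] using hfK.dist_le_mul x hx y hy
      have h4 : |ψ y| ≤ |N| := (hN y hy).trans (le_abs_self N)
      have h5 : |f x - f y| * |ψ y| ≤ K * ‖x - y‖ * |N| :=
        mul_le_mul h3 h4 (abs_nonneg _) (by positivity)
      calc |f x * ψ x - f y * ψ y| = |f x * (ψ x - ψ y) + (f x - f y) * ψ y| := by ring_nf
        _ ≤ |f x| * |ψ x - ψ y| + |f x - f y| * |ψ y| := by
          rw [← abs_mul, ← abs_mul]; exact abs_add_le _ _
        _ ≤ _ := by linarith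
    · rw [hz y hy] at h2 ⊢
      have : 0 ≤ K * |N| * ‖x - y‖ := by positivity
      simp only [sub_zero, mul_zero] at h2 ⊢
      rw [abs_mul]; linarith
  refine ⟨(|M| * L + K * |N|).toNNReal, LipschitzWith.of_dist_le_mul fun x y => ?_⟩
  rw [Real.dist_eq, dist_eq_norm, Real.coe_toNNReal _ (by positivity)]
  by_cases hx : x ∈ closedBall (0 : Em m) ρ
  · exact key x hx y
  by_cases hy : y ∈ closedBall (0 : Em m) ρ
  · rw [abs_sub_comm, norm_sub_rev]; exact key y hy x
  · rw [hz x hx, hz y hy]; simp; positivity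

lemma LipCS.pow {ψ : Em m → ℝ} (hψ : LipCS ψ) (h0 : ∀ x, 0 ≤ ψ x) (h1 : ∀ x, ψ x ≤ 1)
    {k : ℕ} (hk : k ≠ 0) : LipCS (fun x => ψ x ^ k) := by
  obtain ⟨⟨L, hL⟩, hc⟩ := hψ
  refine ⟨⟨k * L, LipschitzWith.of_dist_le_mul fun x y => ?_⟩,
    hc.comp_left (g := fun t : ℝ => t ^ k) (zero_pow hk)⟩
  have h := abs_pow_sub_pow_le (ψ x) (ψ y) k
  have h2 : max |ψ x| |ψ y| ^ (k - 1) ≤ 1 := by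
    refine pow_le_one₀ (le_max_of_le_left (abs_nonneg _)) (max_le ?_ ?_)
    · rw [abs_of_nonneg (h0 x)]; exact h1 x
    · rw [abs_of_nonneg (h0 y)]; exact h1 y
  have h3 := hL.dist_le_mul x y
  rw [Real.dist_eq] at h3 ⊢
  calc _ ≤ _ := h
    _ ≤ |ψ x - ψ y| * k * 1 := by gcongr
    _ ≤ L * dist x y * k * 1 := by gcongr
    _ = _ := by push_cast; ring

lemma gradient_testFunction {u ψ : Em m → ℝ} {s : ℝ} (hs : 0 < s) (k : ℕ) {x : Em m}
    (hu : DifferentiableAt ℝ u x) (hψ : DifferentiableAt ℝ ψ x) :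
    gradient (fun x => |u x| ^ s * u x * ψ x ^ k) x =
      ((s + 1) * |u x| ^ s * ψ x ^ k) • gradient u x +
        (|u x| ^ s * u x * (k * ψ x ^ (k - 1))) • gradient ψ x := by
  have h1 := (hasDerivAt_abs_rpow_mul_self hs (u x)).comp_hasFDerivAt x hu.hasFDerivAt
  have h2 := hψ.hasFDerivAt.pow k
  have h3 := h1.mul h2
  have e : fderiv ℝ (fun x => |u x| ^ s * u x * ψ x ^ k) x = _ := h3.fderiv
  rw [gradient, e]
  simp only [gradient, map_add, map_smul, Function.comp]
  simp only [smul_smul, nsmul_eq_mul]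
  rw [add_comm]
  congr 2
  ring

/-! ### The integral estimate for stable solutions -/

lemma LipCS.integrable_mul_gradient_rpow {ψ G : Em m → ℝ} (hψ : LipCS ψ) (hG : Continuous G)
    (hGc : HasCompactSupport G) {r : ℝ} (hr : 0 ≤ r) :
    Integrable (fun x => G x * ‖gradient ψ x‖ ^ r) := by
  obtain ⟨⟨L, hL⟩, -⟩ := hψ
  refine (hG.integrable_of_hasCompactSupport hGc).mul_bdd (c := (L : ℝ) ^ r)
    ((measurable_gradient ψ).norm.pow_const r).aestronglyMeasurable (ae_of_all _ fun x => ?_)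
  rw [Real.norm_of_nonneg (by positivity)]
  exact Real.rpow_le_rpow (norm_nonneg _) (norm_gradient_le hL x) hr

lemma LipCS.integrable_inner_gradient {u φ : Em m → ℝ} (hu : ContDiff ℝ 1 u) (hφ : LipCS φ)
    {p : ℝ} (hp : 2 ≤ p) :
    Integrable (fun x => ‖gradient u x‖ ^ (p - 2) * ⟪gradient u x, gradient φ x⟫) := by
  obtain ⟨⟨L, hL⟩, hc⟩ := hφ
  have hgu := continuous_gradient hu
  have hcont : Continuous fun x => ‖gradient u x‖ ^ (p - 2) * ‖gradient u x‖ :=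
    (hgu.norm.rpow_const fun _ => Or.inr (by linarith)).mul hgu.norm
  have hK : IsCompact (tsupport (gradient φ)) := hasCompactSupport_gradient hc
  have hI : IntegrableOn (fun x => ‖gradient u x‖ ^ (p - 2) * ‖gradient u x‖ * L)
      (tsupport (gradient φ)) :=
    (hcont.mul continuous_const).continuousOn.integrableOn_compact hK
  rw [← integrableOn_iff_integrable_of_support_subset (s := tsupport (gradient φ))]
  · refine Integrable.mono' hI ?_ (ae_of_all _ fun x => ?_)
    · refine (Measurable.mul ?_ ?_).aestronglyMeasurable
      · exact hgu.measurable.norm.pow_const _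
      · exact hgu.measurable.inner (measurable_gradient φ)
    · rw [norm_mul, Real.norm_of_nonneg (by positivity), mul_assoc]
      gcongr
      exact (norm_inner_le_norm _ _).trans
        (mul_le_mul_of_nonneg_left (norm_gradient_le hL x) (norm_nonneg _))
  · intro x hx
    refine subset_tsupport _ fun h => hx ?_
    simp [h]

section Estimates

variable {p σ γ : ℝ} {k : ℕ} {V u ψ : Em m → ℝ}

lemma integrable_gradientTerm (hp : 2 ≤ p) (hγ : 1 < γ) (hk : 2 ≤ k) (hu : ContDiff ℝ 1 u)
    (hψ : LipCS ψ) :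
    Integrable fun x => ‖gradient u x‖ ^ p * |u x| ^ (γ - 1) * ψ x ^ (2 * k) := by
  have hψc : Continuous ψ := hψ.1.choose_spec.continuous
  refine Continuous.integrable_of_hasCompactSupport ?_ ?_
  · exact (((continuous_gradient hu).norm.rpow_const fun _ => Or.inr (by linarith)).mul
      (hu.continuous.abs.rpow_const fun _ => Or.inr (by linarith))).mul (hψc.pow _)
  · exact (hψ.2.comp_left (g := fun t : ℝ => t ^ (2 * k)) (zero_pow (by omega))).mul_left

lemma integrable_potentialTerm (hσ : 1 < σ) (hγ : 1 < γ) (hk : 2 ≤ k)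
    (hV : LocallyIntegrable V volume) (hu : ContDiff ℝ 1 u) (hψ : LipCS ψ) :
    Integrable fun x => V x * |u x| ^ (σ + γ) * ψ x ^ (2 * k) := by
  have hψc : Continuous ψ := hψ.1.choose_spec.continuous
  have h1 : Continuous fun x => |u x| ^ (σ + γ) * ψ x ^ (2 * k) :=
    (hu.continuous.abs.rpow_const fun _ => Or.inr (by linarith)).mul (hψc.pow _)
  have h2 : HasCompactSupport fun x => |u x| ^ (σ + γ) * ψ x ^ (2 * k) :=
    (hψ.2.comp_left (g := fun t : ℝ => t ^ (2 * k)) (zero_pow (by omega))).mul_left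
  refine (hV.integrable_smul_left_of_hasCompactSupport h1 h2).congr (ae_of_all _ fun x => ?_)
  simp only [smul_eq_mul]; ring

lemma integrable_crossTerm (hp : 2 ≤ p) (hγ : 1 < γ) (hk : 2 ≤ k) (hu : ContDiff ℝ 1 u)
    (hψ : LipCS ψ) :
    Integrable fun x =>
      ‖gradient u x‖ ^ (p - 1) * |u x| ^ γ * ψ x ^ (2 * k - 1) * ‖gradient ψ x‖ := by
  have hψc : Continuous ψ := hψ.1.choose_spec.continuous
  have := hψ.integrable_mul_gradient_rpow (r := 1)
    (G := fun x => ‖gradient u x‖ ^ (p - 1) * |u x| ^ γ * ψ x ^ (2 * k - 1)) ?_ ?_ one_pos.le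
  · simpa using this
  · exact (((continuous_gradient hu).norm.rpow_const fun _ => Or.inr (by linarith)).mul
      (hu.continuous.abs.rpow_const fun _ => Or.inr (by linarith))).mul (hψc.pow _)
  · exact (hψ.2.comp_left (g := fun t : ℝ => t ^ (2 * k - 1)) (zero_pow (by omega))).mul_left

lemma integrable_squareTerm (hp : 2 ≤ p) (hγ : 1 < γ) (hk : 2 ≤ k) (hu : ContDiff ℝ 1 u)
    (hψ : LipCS ψ) :
    Integrable fun x =>
      ‖gradient u x‖ ^ (p - 2) * |u x| ^ (γ + 1) * ψ x ^ (2 * k - 2) * ‖gradient ψ x‖ ^ 2 := by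
  have hψc : Continuous ψ := hψ.1.choose_spec.continuous
  have := hψ.integrable_mul_gradient_rpow (r := 2)
    (G := fun x => ‖gradient u x‖ ^ (p - 2) * |u x| ^ (γ + 1) * ψ x ^ (2 * k - 2)) ?_ ?_ (by simp)
  · simpa using this
  · exact (((continuous_gradient hu).norm.rpow_const fun _ => Or.inr (by linarith)).mul
      (hu.continuous.abs.rpow_const fun _ => Or.inr (by linarith))).mul (hψc.pow _)
  · exact (hψ.2.comp_left (g := fun t : ℝ => t ^ (2 * k - 2)) (zero_pow (by omega))).mul_left

lemma integrable_cutoffTerm (hp : 2 ≤ p) (hγ : 1 < γ) (hk : p < 2 * k) (hu : ContDiff ℝ 1 u)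
    (hψ : LipCS ψ) :
    Integrable fun x =>
      |u x| ^ (γ + p - 1) * ψ x ^ (2 * k - p) * ‖gradient ψ x‖ ^ p := by
  have hψc : Continuous ψ := hψ.1.choose_spec.continuous
  refine hψ.integrable_mul_gradient_rpow ?_ ?_ (by linarith)
  · exact (hu.continuous.abs.rpow_const fun _ => Or.inr (by linarith)).mul
      (hψc.rpow_const fun _ => Or.inr (by linarith))
  · exact (hψ.2.comp_left (g := fun t : ℝ => t ^ (2 * k - p))
      (Real.zero_rpow (by linarith))).mul_left

lemma lipCS_testFunction {s : ℝ} (hs : 0 < s) (hu : ContDiff ℝ 1 u) (hψ : LipCS ψ)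
    (h0 : ∀ x, 0 ≤ ψ x) (h1 : ∀ x, ψ x ≤ 1) {n : ℕ} (hn : n ≠ 0) :
    LipCS (fun x => |u x| ^ s * u x * ψ x ^ n) :=
  ((hψ.pow h0 h1 hn).mul_contDiff ((contDiff_abs_rpow_mul_self hs).comp hu))

lemma ae_gradient_testFunction {s : ℝ} (hs : 0 < s) (n : ℕ) (hu : ContDiff ℝ 1 u)
    (hψ : LipCS ψ) :
    ∀ᵐ x, gradient (fun x => |u x| ^ s * u x * ψ x ^ n) x =
      ((s + 1) * |u x| ^ s * ψ x ^ n) • gradient u x +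
        (|u x| ^ s * u x * (n * ψ x ^ (n - 1))) • gradient ψ x := by
  obtain ⟨L, hL⟩ := hψ.1
  filter_upwards [hL.ae_differentiableAt (μ := volume)] with x hx
  exact gradient_testFunction hs n (hu.differentiable (by norm_num) x) hx

lemma weak_inequality (hp : 2 ≤ p) (hσ : 1 < σ) (hγ : 1 < γ) (hk : 2 ≤ k)
    (hu : IsWeakSol p σ V u) (hψ : LipCS ψ) (h0 : ∀ x, 0 ≤ ψ x) (h1 : ∀ x, ψ x ≤ 1) :
    γ * ∫ x, ‖gradient u x‖ ^ p * |u x| ^ (γ - 1) * ψ x ^ (2 * k) ≤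
      (∫ x, V x * |u x| ^ (σ + γ) * ψ x ^ (2 * k)) +
        2 * k * ∫ x, ‖gradient u x‖ ^ (p - 1) * |u x| ^ γ * ψ x ^ (2 * k - 1) * ‖gradient ψ x‖ := by
  obtain ⟨hu1, -, -, hw⟩ := hu
  have hs : 0 < γ - 1 := by linarith
  have hφ : LipCS (fun x => |u x| ^ (γ - 1) * u x * ψ x ^ (2 * k)) :=
    lipCS_testFunction hs hu1 hψ h0 h1 (by omega)
  have hweak := hw _ hφ
  have hA := integrable_gradientTerm hp hγ hk hu1 hψ
  have hD := integrable_crossTerm hp hγ hk hu1 hψ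
  have hB : (∫ x, V x * |u x| ^ (σ - 1) * u x * (|u x| ^ (γ - 1) * u x * ψ x ^ (2 * k))) =
      ∫ x, V x * |u x| ^ (σ + γ) * ψ x ^ (2 * k) := by
    congr 1; ext x
    have : |u x| ^ (σ + γ) = |u x| ^ (σ - 1) * |u x| ^ (γ - 1) * |u x| ^ 2 := by
      rw [← Real.rpow_natCast, ← Real.rpow_add' (abs_nonneg _) (by linarith),
        ← Real.rpow_add' (abs_nonneg _) (by norm_num; linarith)]
      norm_num; ring_nf
    rw [this, sq_abs]; ring
  rw [hB] at hweak
  rw [← hweak, ← sub_le_iff_le_add, ← integral_const_mul, ← integral_const_mul,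
    ← integral_sub (hA.const_mul _) (hD.const_mul _)]
  refine integral_mono_ae ((hA.const_mul _).sub (hD.const_mul _))
    (hφ.integrable_inner_gradient hu1 hp) ?_
  filter_upwards [ae_gradient_testFunction hs (2 * k) hu1 hψ] with x hx
  rw [hx, inner_add_right, real_inner_smul_right, real_inner_smul_right,
    real_inner_self_eq_norm_sq]
  have hin : |⟪gradient u x, gradient ψ x⟫| ≤ ‖gradient u x‖ * ‖gradient ψ x‖ :=
    abs_real_inner_le_norm _ _
  have ht := h0 x
  set a := ‖gradient u x‖
  set g := ‖gradient ψ x‖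
  set i := ⟪gradient u x, gradient ψ x⟫
  set t := ψ x
  have ha : 0 ≤ a := norm_nonneg _
  have e1 : a ^ p = a ^ (p - 2) * a ^ 2 := by
    rw [← Real.rpow_natCast a, ← Real.rpow_add' ha (by norm_num; linarith)]; norm_num
  have e2 : a ^ (p - 1) = a ^ (p - 2) * a := by
    rw [← Real.rpow_add_one' ha (by linarith)]; ring_nf
  have e3 : |u x| ^ γ = |u x| ^ (γ - 1) * |u x| := by
    rw [← Real.rpow_add_one' (abs_nonneg _) (by linarith)]; ring_nf
  have h2 : -(|u x| * (a * g)) ≤ u x * i := by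
    refine (neg_le_neg ?_).trans (neg_abs_le (u x * i))
    rw [abs_mul]; gcongr
  have h3 : 0 ≤ a ^ (p - 2) * |u x| ^ (γ - 1) * (2 * k) * t ^ (2 * k - 1) := by positivity
  have h4 := mul_le_mul_of_nonneg_left h2 h3
  rw [e1, e2, e3]
  push_cast
  linarith

lemma stable_inequality (hp : 2 ≤ p) (hσ : 1 < σ) (hγ : 1 < γ) (hk : 2 ≤ k)
    (hu : ContDiff ℝ 1 u) (hst : IsStable p σ V u) (hψ : LipCS ψ) (h0 : ∀ x, 0 ≤ ψ x)
    (h1 : ∀ x, ψ x ≤ 1) :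
    σ * ∫ x, V x * |u x| ^ (σ + γ) * ψ x ^ (2 * k) ≤
      (p - 1) * ((γ + 1) ^ 2 / 4 * (∫ x, ‖gradient u x‖ ^ p * |u x| ^ (γ - 1) * ψ x ^ (2 * k)) +
        (γ + 1) * k * (∫ x, ‖gradient u x‖ ^ (p - 1) * |u x| ^ γ * ψ x ^ (2 * k - 1) *
          ‖gradient ψ x‖) +
        k ^ 2 * ∫ x, ‖gradient u x‖ ^ (p - 2) * |u x| ^ (γ + 1) * ψ x ^ (2 * k - 2) *
          ‖gradient ψ x‖ ^ 2) := by
  have hs : 0 < (γ - 1) / 2 := by linarith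
  have hφ : LipCS (fun x => |u x| ^ ((γ - 1) / 2) * u x * ψ x ^ k) :=
    lipCS_testFunction hs hu hψ h0 h1 (by omega)
  have hstab := hst _ hφ
  have hA := integrable_gradientTerm hp hγ hk hu hψ
  have hD := integrable_crossTerm hp hγ hk hu hψ
  have hE := integrable_squareTerm hp hγ hk hu hψ
  have eu : ∀ y : ℝ, (|y| ^ ((γ - 1) / 2)) ^ 2 = |y| ^ (γ - 1) := fun y => by
    rw [← Real.rpow_natCast, ← Real.rpow_mul (abs_nonneg _)]; norm_num
  have hB : (∫ x, V x * |u x| ^ (σ - 1) * (|u x| ^ ((γ - 1) / 2) * u x * ψ x ^ k) ^ 2) =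
      ∫ x, V x * |u x| ^ (σ + γ) * ψ x ^ (2 * k) := by
    congr 1; ext x
    have : |u x| ^ (σ + γ) = |u x| ^ (σ - 1) * |u x| ^ (γ - 1) * |u x| ^ 2 := by
      rw [← Real.rpow_natCast, ← Real.rpow_add' (abs_nonneg _) (by linarith),
        ← Real.rpow_add' (abs_nonneg _) (by norm_num; linarith)]
      norm_num; ring_nf
    rw [this, sq_abs, ← eu, pow_mul']; ring
  rw [hB] at hstab
  set φ := fun x => |u x| ^ ((γ - 1) / 2) * u x * ψ x ^ k
  set T := fun x => (γ + 1) ^ 2 / 4 * (‖gradient u x‖ ^ p * |u x| ^ (γ - 1) * ψ x ^ (2 * k)) +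
    (γ + 1) * k * (‖gradient u x‖ ^ (p - 1) * |u x| ^ γ * ψ x ^ (2 * k - 1) * ‖gradient ψ x‖) +
    k ^ 2 * (‖gradient u x‖ ^ (p - 2) * |u x| ^ (γ + 1) * ψ x ^ (2 * k - 2) *
      ‖gradient ψ x‖ ^ 2) with hT
  have hTi : Integrable T := ((hA.const_mul _).add (hD.const_mul _)).add (hE.const_mul _)
  have hTe : ∫ x, T x = (γ + 1) ^ 2 / 4 *
        (∫ x, ‖gradient u x‖ ^ p * |u x| ^ (γ - 1) * ψ x ^ (2 * k)) +
        (γ + 1) * k * (∫ x, ‖gradient u x‖ ^ (p - 1) * |u x| ^ γ * ψ x ^ (2 * k - 1) *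
          ‖gradient ψ x‖) +
        k ^ 2 * ∫ x, ‖gradient u x‖ ^ (p - 2) * |u x| ^ (γ + 1) * ψ x ^ (2 * k - 2) *
          ‖gradient ψ x‖ ^ 2 := by
    rw [← integral_const_mul, ← integral_const_mul, ← integral_const_mul,
      ← integral_add (hA.const_mul _) (hD.const_mul _)]
    exact integral_add ((hA.const_mul _).add (hD.const_mul _)) (hE.const_mul _)
  have hle : ∀ᵐ x, ‖gradient u x‖ ^ (p - 2) * ‖gradient φ x‖ ^ 2 ≤ T x := by
    filter_upwards [ae_gradient_testFunction hs k hu hψ] with x hx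
    have hx' : gradient φ x = _ := hx
    have ht := h0 x
    have hn : ‖gradient φ x‖ ≤ (γ + 1) / 2 * |u x| ^ ((γ - 1) / 2) * ψ x ^ k * ‖gradient u x‖ +
        |u x| ^ ((γ - 1) / 2) * |u x| * (k * ψ x ^ (k - 1)) * ‖gradient ψ x‖ := by
      rw [hx']
      refine (norm_add_le _ _).trans (le_of_eq ?_)
      rw [norm_smul, norm_smul]
      simp only [norm_mul, Real.norm_eq_abs, abs_pow, Nat.abs_cast,
        Real.abs_rpow_of_nonneg (abs_nonneg (u x)), abs_abs, abs_of_nonneg ht]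
      rw [abs_of_pos (by linarith : 0 < (γ - 1) / 2 + 1)]
      ring
    rw [hT]
    simp only
    set a := ‖gradient u x‖
    set g := ‖gradient ψ x‖
    set t := ψ x
    have ha : 0 ≤ a := norm_nonneg _
    have e1 : a ^ p = a ^ (p - 2) * a ^ 2 := by
      rw [← Real.rpow_natCast a, ← Real.rpow_add' ha (by norm_num; linarith)]; norm_num
    have e2 : a ^ (p - 1) = a ^ (p - 2) * a := by
      rw [← Real.rpow_add_one' ha (by linarith)]; ring_nf
    have e3 : |u x| ^ γ = |u x| ^ (γ - 1) * |u x| := by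
      rw [← Real.rpow_add_one' (abs_nonneg _) (by linarith)]; ring_nf
    have e4 : |u x| ^ (γ + 1) = |u x| ^ (γ - 1) * |u x| ^ 2 := by
      rw [← Real.rpow_natCast, ← Real.rpow_add' (abs_nonneg _) (by norm_num; linarith)]
      norm_num; ring_nf
    obtain ⟨l, rfl⟩ : ∃ l, k = l + 1 := ⟨k - 1, by omega⟩
    rw [e1, e2, e3, e4, ← eu, show 2 * (l + 1) - 1 = 2 * l + 1 by omega,
      show 2 * (l + 1) - 2 = 2 * l by omega]
    simp only [Nat.add_sub_cancel] at hn
    calc _ ≤ a ^ (p - 2) * ((γ + 1) / 2 * |u x| ^ ((γ - 1) / 2) * t ^ (l + 1) * a +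
        |u x| ^ ((γ - 1) / 2) * |u x| * (((l + 1 : ℕ) : ℝ) * t ^ l) * g) ^ 2 := by gcongr
      _ = _ := by ring
  have hφi : (∫ x, ‖gradient u x‖ ^ (p - 2) * ‖gradient φ x‖ ^ 2) ≤ ∫ x, T x :=
    integral_mono_of_nonneg (ae_of_all _ fun x => by positivity) hTi hle
  have hφj : (∫ x, ‖gradient u x‖ ^ (p - 4) * ⟪gradient u x, gradient φ x⟫ ^ 2) ≤ ∫ x, T x := by
    refine integral_mono_of_nonneg (ae_of_all _ fun x => by positivity) hTi ?_
    filter_upwards [hle] with x hx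
    refine le_trans ?_ hx
    rcases (norm_nonneg (gradient u x)).eq_or_lt with ha | ha
    · have : gradient u x = 0 := norm_eq_zero.1 ha.symm
      rw [this, inner_zero_left]
      simp only [ne_eq, OfNat.ofNat_ne_zero, not_false_eq_true, zero_pow, mul_zero]
      positivity
    · have e : ‖gradient u x‖ ^ (p - 2) = ‖gradient u x‖ ^ (p - 4) * ‖gradient u x‖ ^ 2 := by
        rw [← Real.rpow_natCast, ← Real.rpow_add ha]; norm_num; ring_nf
      rw [e, mul_assoc, ← mul_pow, ← sq_abs ⟪gradient u x, gradient φ x⟫]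
      gcongr
      exact abs_real_inner_le_norm _ _
  rw [← hTe]
  have := mul_le_mul_of_nonneg_left hφj (by linarith : 0 ≤ p - 2)
  linarith

end Estimates

lemma alphaC_sub (p σ δ : ℝ) :
    p * (σ + (gammaBar p σ - δ)) / (σ - p + 1) = alphaC p σ - p * (δ / (σ - p + 1)) := by
  unfold alphaC; ring

lemma betaC_sub (p σ δ : ℝ) :
    (gammaBar p σ - δ + p - 1) / (σ - p + 1) = betaC p σ - δ / (σ - p + 1) := by
  unfold betaC; ring

lemma lt_alphaC {p σ : ℝ} (hp : 2 ≤ p) (hσ : p - 1 < σ) : p < alphaC p σ := by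
  have := one_lt_gammaBar hp hσ
  rw [alphaC, lt_div_iff₀ (by linarith)]
  nlinarith

theorem stable_integral_estimate {p σ : ℝ} (hp : 2 ≤ p) (hσ : p - 1 < σ) :
    ∃ K > (0 : ℝ), ∃ δ₁ > (0 : ℝ), δ₁ ≤ 1 ∧ δ₁ ≤ gammaBar p σ - 1 ∧ ∃ k : ℕ,
      ∀ δ : ℝ, 0 < δ → δ < δ₁ → ∀ m : ℕ, ∀ V : Em m → ℝ, LocallyIntegrable V volume →
        (∀ᵐ x : Em m, 0 < V x) → ∀ u : Em m → ℝ, IsWeakSol p σ V u → IsStable p σ V u →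
        ∀ ψ : Em m → ℝ, LipCS ψ → (∀ x, 0 ≤ ψ x) → (∀ x, ψ x ≤ 1) →
          (∫⁻ x, ENNReal.ofReal (V x * |u x| ^ (σ + (gammaBar p σ - δ)) * ψ x ^ (2 * k))) ≤
            ENNReal.ofReal K * ∫⁻ x, ENNReal.ofReal (V x ^ (-(betaC p σ) + δ / (σ - p + 1)) *
              (‖gradient ψ x‖ / δ) ^ (alphaC p σ - p * (δ / (σ - p + 1)))) := by
  have hg := one_lt_gammaBar hp hσ
  have hα := lt_alphaC hp hσ
  obtain ⟨k, hkα⟩ := exists_nat_ge (alphaC p σ / 2)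
  have hk2 : 2 ≤ k := by
    have : (1 : ℝ) < k := by linarith
    exact_mod_cast this
  have hkp : p < 2 * k := by linarith
  obtain ⟨K₀, hK₀, δ₁, hδ₁, hδ₁1, hδ₁g, habs⟩ :=
    absorb_error_terms hp hσ (k := k) (by linarith)
  set K₁ := max 1 K₀ with hK₁
  have hK₁1 : 1 ≤ K₁ := le_max_left _ _
  refine ⟨2 * K₁ * (2 * K₁) ^ betaC p σ, by positivity, δ₁, hδ₁, hδ₁1, hδ₁g, k, ?_⟩
  intro δ hδ hδδ m V hV hVpos u hu hst ψ hψ h0 h1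
  have hbs := betaC_sub p σ δ
  have has := alphaC_sub p σ δ
  have hd : 0 < σ - p + 1 := by linarith
  have habs := habs δ hδ hδδ
  obtain ⟨γ, hγ⟩ : ∃ γ, γ = gammaBar p σ - δ := ⟨_, rfl⟩
  rw [← hγ] at hbs has habs ⊢
  have hγ1 : 1 < γ := by linarith
  have hσ1 : 1 < σ := by linarith
  set b := betaC p σ - δ / (σ - p + 1) with hb
  have hb0 : 0 < b := by rw [← hbs]; exact div_pos (by linarith) hd
  rw [show -(betaC p σ) + δ / (σ - p + 1) = -b by rw [hb]; ring]
  set a := alphaC p σ - p * (δ / (σ - p + 1)) with ha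
  have haα : a ≤ 2 * k := by
    have : 0 ≤ p * (δ / (σ - p + 1)) := by positivity
    linarith
  set G : Em m → ℝ := fun x => V x ^ (-b) * (‖gradient ψ x‖ / δ) ^ a with hG
  have hu1 := hu.1
  have hA := integrable_gradientTerm hp hγ1 hk2 hu1 hψ
  have hD := integrable_crossTerm hp hγ1 hk2 hu1 hψ
  have hE := integrable_squareTerm hp hγ1 hk2 hu1 hψ
  have hF := integrable_cutoffTerm hp hγ1 hkp hu1 hψ
  have hB := integrable_potentialTerm hσ1 hγ1 hk2 hV hu1 hψ
  have hweak := weak_inequality hp hσ1 hγ1 hk2 hu hψ h0 h1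
  have hstab := stable_inequality hp hσ1 hγ1 hk2 hu1 hst hψ h0 h1
  have hGm : AEStronglyMeasurable G volume :=
    ((hV.aestronglyMeasurable.aemeasurable.pow_const _).mul
      (((measurable_gradient ψ).norm.div_const _).pow_const _).aemeasurable).aestronglyMeasurable
  have hG0 : 0 ≤ᵐ[volume] G := by
    filter_upwards [hVpos] with x hx
    simp only [hG, Pi.zero_apply]; positivity
  have hB0 : 0 ≤ᵐ[volume] fun x => V x * |u x| ^ (σ + γ) * ψ x ^ (2 * k) := by
    filter_upwards [hVpos] with x hx
    have := h0 x
    simp only [Pi.zero_apply]; positivity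
  rcases eq_or_ne (∫⁻ x, ENNReal.ofReal (G x)) ⊤ with htop | htop
  · rw [htop, ENNReal.mul_top (by simp; positivity)]
    exact le_top
  have hGi : Integrable G := (lintegral_ofReal_ne_top_iff_integrable hGm hG0).1 htop
  rw [← ofReal_integral_eq_lintegral_ofReal hGi hG0, ← ofReal_integral_eq_lintegral_ofReal hB hB0,
    ← ENNReal.ofReal_mul (by positivity)]
  refine ENNReal.ofReal_le_ofReal ?_
  -- pointwise factorisations
  have hfac : ∀ x, ‖gradient u x‖ ^ p * |u x| ^ (γ - 1) * ψ x ^ (2 * k) =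
        (|u x| ^ (γ - 1) * ψ x ^ (2 * k - p)) * (‖gradient u x‖ * ψ x) ^ p ∧
      ‖gradient u x‖ ^ (p - 1) * |u x| ^ γ * ψ x ^ (2 * k - 1) * ‖gradient ψ x‖ =
        (|u x| ^ (γ - 1) * ψ x ^ (2 * k - p)) *
          ((‖gradient u x‖ * ψ x) ^ (p - 1) * (|u x| * ‖gradient ψ x‖)) ∧
      ‖gradient u x‖ ^ (p - 2) * |u x| ^ (γ + 1) * ψ x ^ (2 * k - 2) * ‖gradient ψ x‖ ^ 2 =
        (|u x| ^ (γ - 1) * ψ x ^ (2 * k - p)) *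
          ((‖gradient u x‖ * ψ x) ^ (p - 2) * (|u x| * ‖gradient ψ x‖) ^ 2) ∧
      |u x| ^ (γ + p - 1) * ψ x ^ (2 * k - p) * ‖gradient ψ x‖ ^ p =
        (|u x| ^ (γ - 1) * ψ x ^ (2 * k - p)) * (|u x| * ‖gradient ψ x‖) ^ p := by
    intro x
    have ht := h0 x
    have hw := abs_nonneg (u x)
    have hn := norm_nonneg (gradient u x)
    have t1 : ψ x ^ (2 * k) = ψ x ^ ((2 * k : ℝ) - p) * ψ x ^ p := by
      rw [← Real.rpow_add' ht (by linarith), ← Real.rpow_natCast]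
      push_cast; ring_nf
    have t2 : ψ x ^ (2 * k - 1) = ψ x ^ ((2 * k : ℝ) - p) * ψ x ^ (p - 1) := by
      rw [← Real.rpow_add' ht (by linarith), ← Real.rpow_natCast, Nat.cast_sub (by omega)]
      push_cast; ring_nf
    have t3 : ψ x ^ (2 * k - 2) = ψ x ^ ((2 * k : ℝ) - p) * ψ x ^ (p - 2) := by
      rw [← Real.rpow_add' ht (by linarith), ← Real.rpow_natCast, Nat.cast_sub (by omega)]
      push_cast; ring_nf
    have w1 : |u x| ^ γ = |u x| ^ (γ - 1) * |u x| := by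
      rw [← Real.rpow_add_one' hw (by linarith)]; ring_nf
    have w2 : |u x| ^ (γ + 1) = |u x| ^ (γ - 1) * |u x| ^ 2 := by
      rw [← Real.rpow_natCast, ← Real.rpow_add' hw (by norm_num; linarith)]
      norm_num; ring_nf
    have w3 : |u x| ^ (γ + p - 1) = |u x| ^ (γ - 1) * |u x| ^ p := by
      rw [← Real.rpow_add' hw (by linarith)]; ring_nf
    refine ⟨?_, ?_, ?_, ?_⟩
    · rw [Real.mul_rpow hn ht, t1]; ring
    · rw [Real.mul_rpow hn ht, t2, w1]; ring
    · rw [Real.mul_rpow hn ht, t3, w2]; ring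
    · rw [Real.mul_rpow hw (norm_nonneg _), w3]; ring
  have hmain := habs _ _ _ _ _
    (integral_nonneg fun x => by have := h0 x; positivity) (integral_nonneg_of_ae hB0)
    (integral_nonneg fun x => by have := h0 x; positivity)
    (integral_nonneg fun x => by have := h0 x; positivity)
    (integral_nonneg fun x => by
      have := h0 x
      change 0 ≤ |u x| ^ (γ + p - 1) * ψ x ^ (2 * k - p) * ‖gradient ψ x‖ ^ p
      positivity)
    hweak hstab
    (fun η hη hη1 => by
      rw [← integral_const_mul, ← integral_const_mul,
        ← integral_add (hA.const_mul _) (hF.const_mul _)]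
      refine integral_mono hD ((hA.const_mul _).add (hF.const_mul _)) fun x => ?_
      obtain ⟨e1, e2, -, e4⟩ := hfac x
      have ht := h0 x
      simp only [e1, e2, e4]
      refine (mul_le_mul_of_nonneg_left (rpow_mul_le_add hp (X := ‖gradient u x‖ * ψ x)
        (Y := |u x| * ‖gradient ψ x‖) (by positivity) (by positivity) hη)
        (by positivity)).trans (le_of_eq (by ring)))
    (fun η hη hη1 => by
      rw [← integral_const_mul, ← integral_const_mul,
        ← integral_add (hA.const_mul _) (hF.const_mul _)]
      refine integral_mono hE ((hA.const_mul _).add (hF.const_mul _)) fun x => ?_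
      obtain ⟨e1, -, e3, e4⟩ := hfac x
      have ht := h0 x
      simp only [e1, e3, e4]
      refine (mul_le_mul_of_nonneg_left (rpow_mul_sq_le_add hp (X := ‖gradient u x‖ * ψ x)
        (Y := |u x| * ‖gradient ψ x‖) (by positivity) (by positivity) hη hη1)
        (by positivity)).trans (le_of_eq (by ring)))
  have hF0 : 0 ≤ ∫ x, |u x| ^ (γ + p - 1) * ψ x ^ (2 * k - p) * ‖gradient ψ x‖ ^ p :=
    integral_nonneg fun x => by
      have := h0 x
      change 0 ≤ |u x| ^ (γ + p - 1) * ψ x ^ (2 * k - p) * ‖gradient ψ x‖ ^ p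
      positivity
  have hmain' := hmain.trans (mul_le_mul_of_nonneg_right (le_max_right 1 K₀)
    (mul_nonneg (Real.rpow_nonneg hδ.le _) hF0))
  rw [← hK₁] at hmain'
  have hFG : δ ^ (-p) * (∫ x, |u x| ^ (γ + p - 1) * ψ x ^ (2 * k - p) * ‖gradient ψ x‖ ^ p) ≤
      (2 * K₁)⁻¹ * (∫ x, V x * |u x| ^ (σ + γ) * ψ x ^ (2 * k)) +
        (2 * K₁) ^ b * ∫ x, G x := by
    rw [← integral_const_mul, ← integral_const_mul, ← integral_const_mul,
      ← integral_add (hB.const_mul _) (hGi.const_mul _)]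
    refine integral_mono_ae (hF.const_mul _) ((hB.const_mul _).add (hGi.const_mul _)) ?_
    filter_upwards [hVpos] with x hx
    have hY := rpow_mul_le_weighted hp hσ hγ1 (q := 2 * k) (has.le.trans haα) (abs_nonneg (u x))
      (h0 x) (h1 x) (div_nonneg (norm_nonneg (gradient ψ x)) hδ.le) hx
      (inv_pos.2 (by positivity : 0 < 2 * K₁))
    rw [hbs, has, Real.inv_rpow (by positivity), Real.rpow_neg (by positivity), inv_inv,
      Real.div_rpow (norm_nonneg _) hδ.le, div_eq_mul_inv, ← Real.rpow_neg hδ.le,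
      show ψ x ^ (2 * k : ℝ) = ψ x ^ (2 * k) by rw [← Real.rpow_natCast]; push_cast; rfl] at hY
    simp only [hG]
    linarith
  have hb' : (2 * K₁) ^ b ≤ (2 * K₁) ^ betaC p σ := by
    refine Real.rpow_le_rpow_of_exponent_le (by linarith) ?_
    have : 0 ≤ δ / (σ - p + 1) := by positivity
    linarith
  have hGn : 0 ≤ ∫ x, G x := integral_nonneg_of_ae hG0
  have h5 := mul_le_mul_of_nonneg_left hFG (by positivity : 0 ≤ K₁)
  have h6 : K₁ * ((2 * K₁) ^ b * ∫ x, G x) ≤ K₁ * ((2 * K₁) ^ betaC p σ * ∫ x, G x) := by gcongr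
  have e7 : K₁ * ((2 * K₁)⁻¹ * (∫ x, V x * |u x| ^ (σ + γ) * ψ x ^ (2 * k))) =
      (∫ x, V x * |u x| ^ (σ + γ) * ψ x ^ (2 * k)) / 2 := by field_simp
  rw [mul_add, e7] at h5
  linarith

/-! ### Logarithmic cut-off functions -/

lemma abs_log_sub_log_le {a x y : ℝ} (ha : 0 < a) (hx : a ≤ x) (hy : a ≤ y) :
    |Real.log x - Real.log y| ≤ a⁻¹ * |x - y| := by
  have key : ∀ x y : ℝ, a ≤ x → x ≤ y → Real.log y - Real.log x ≤ a⁻¹ * (y - x) := by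
    intro x y hx hxy
    have hx0 : 0 < x := ha.trans_le hx
    rw [← Real.log_div (by linarith) hx0.ne']
    refine (Real.log_le_sub_one_of_pos (div_pos (by linarith) hx0)).trans ?_
    rw [show y / x - 1 = x⁻¹ * (y - x) by field_simp]
    have : 0 ≤ y - x := by linarith
    gcongr
  rcases le_total x y with h | h
  · have hl := Real.log_le_log (ha.trans_le hx) h
    rw [abs_sub_comm, abs_sub_comm x, abs_of_nonneg (by linarith), abs_of_nonneg (by linarith)]
    exact key x y hx h
  · have hl := Real.log_le_log (ha.trans_le hy) h
    rw [abs_of_nonneg (by linarith), abs_of_nonneg (by linarith)]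
    exact key y x hy h

/-- The cut-off equal to `1` on the ball of radius `2 ^ n`, vanishing outside the ball of radius
`2 ^ (2 * n)`, and affine in `log ‖x‖` in between. -/
def logCutoff (m n : ℕ) (x : Em m) : ℝ :=
  max 0 (min 1 (2 - Real.log (max ‖x‖ 1) / (n * Real.log 2)))

lemma logCutoff_nonneg (n : ℕ) (x : Em m) : 0 ≤ logCutoff m n x := le_max_left _ _

lemma logCutoff_le_one (n : ℕ) (x : Em m) : logCutoff m n x ≤ 1 :=
  max_le zero_le_one (min_le_left _ _)

lemma abs_logCutoff_sub_le (n : ℕ) {a : ℝ} (ha : 1 ≤ a) {x y : Em m}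
    (hx : max ‖x‖ 1 = max ‖x‖ a) (hy : max ‖y‖ 1 = max ‖y‖ a) :
    |logCutoff m n x - logCutoff m n y| ≤ (n * Real.log 2)⁻¹ * a⁻¹ * ‖x - y‖ := by
  have hl : 0 ≤ (n * Real.log 2 : ℝ)⁻¹ := inv_nonneg.2 (mul_nonneg n.cast_nonneg
    (Real.log_nonneg (by norm_num)))
  unfold logCutoff
  rw [hx, hy]
  refine (abs_max_sub_max_le_max _ _ _ _).trans ?_
  rw [sub_self, abs_zero, max_eq_right (abs_nonneg _)]
  refine (abs_min_sub_min_le_max _ _ _ _).trans ?_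
  rw [sub_self, abs_zero, max_eq_right (abs_nonneg _)]
  have h1 := abs_log_sub_log_le (by linarith) (le_max_right ‖x‖ a) (le_max_right ‖y‖ a)
  have h2 : |max ‖x‖ a - max ‖y‖ a| ≤ ‖x - y‖ := by
    refine (abs_max_sub_max_le_max _ _ _ _).trans ?_
    rw [sub_self, abs_zero, max_eq_left (abs_nonneg _)]
    exact abs_norm_sub_norm_le x y
  calc |2 - Real.log (max ‖x‖ a) / (n * Real.log 2) - (2 - Real.log (max ‖y‖ a) / (n * Real.log 2))|
      = (n * Real.log 2)⁻¹ * |Real.log (max ‖x‖ a) - Real.log (max ‖y‖ a)| := by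
        rw [← abs_of_nonneg hl, ← abs_mul, ← abs_neg]; congr 1; ring
    _ ≤ (n * Real.log 2)⁻¹ * (a⁻¹ * ‖x - y‖) := by
        gcongr
        exact h1.trans (by gcongr)
    _ = _ := by ring

lemma logCutoff_eq_one {n : ℕ} (hn : 1 ≤ n) {x : Em m} (hx : ‖x‖ ≤ 2 ^ n) :
    logCutoff m n x = 1 := by
  have hl : 0 < n * Real.log 2 := mul_pos (by exact_mod_cast hn) (Real.log_pos (by norm_num))
  have h1 : Real.log (max ‖x‖ 1) ≤ n * Real.log 2 := by
    rw [← Real.log_pow]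
    exact Real.log_le_log (by positivity) (max_le hx (one_le_pow₀ (by norm_num)))
  have h2 : Real.log (max ‖x‖ 1) / (n * Real.log 2) ≤ 1 := (div_le_one hl).2 h1
  rw [logCutoff, min_eq_left (by linarith), max_eq_right zero_le_one]

lemma logCutoff_eq_zero {n : ℕ} (hn : 1 ≤ n) {x : Em m} (hx : 2 ^ (2 * n) ≤ ‖x‖) :
    logCutoff m n x = 0 := by
  have hl : 0 < n * Real.log 2 := mul_pos (by exact_mod_cast hn) (Real.log_pos (by norm_num))
  have h1 : 2 * (n * Real.log 2) ≤ Real.log (max ‖x‖ 1) := by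
    have : 2 * (n * Real.log 2) = Real.log (2 ^ (2 * n)) := by
      rw [Real.log_pow]; push_cast; ring
    rw [this]
    exact Real.log_le_log (by positivity) (hx.trans (le_max_left _ _))
  have h2 : 2 ≤ Real.log (max ‖x‖ 1) / (n * Real.log 2) := (le_div_iff₀ hl).2 h1
  rw [logCutoff, max_eq_left]
  exact (min_le_right _ _).trans (by linarith)

lemma lipCS_logCutoff {n : ℕ} (hn : 1 ≤ n) : LipCS (logCutoff m n) := by
  have hl : 0 < n * Real.log 2 := mul_pos (by exact_mod_cast hn) (Real.log_pos (by norm_num))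
  refine ⟨⟨(n * Real.log 2)⁻¹.toNNReal, LipschitzWith.of_dist_le_mul fun x y => ?_⟩, ?_⟩
  · rw [Real.dist_eq, dist_eq_norm, Real.coe_toNNReal _ (by positivity)]
    simpa using abs_logCutoff_sub_le n le_rfl (x := x) (y := y) rfl rfl
  · refine HasCompactSupport.of_support_subset_isCompact
      (isCompact_closedBall (0 : Em m) (2 ^ (2 * n))) fun x hx => ?_
    rw [mem_closedBall_zero_iff]
    by_contra h
    exact hx (logCutoff_eq_zero hn (not_le.1 h).le)

lemma gradient_logCutoff_eq_zero {n : ℕ} (hn : 1 ≤ n) {x : Em m}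
    (hx : ‖x‖ < 2 ^ n ∨ 2 ^ (2 * n) ≤ ‖x‖) : gradient (logCutoff m n) x = 0 := by
  rw [← norm_eq_zero, norm_gradient, norm_eq_zero]
  rcases hx with hx | hx
  · refine IsLocalMax.fderiv_eq_zero (Eventually.of_forall fun y => ?_)
    rw [logCutoff_eq_one hn hx.le]
    exact logCutoff_le_one n y
  · refine IsLocalMin.fderiv_eq_zero (Eventually.of_forall fun y => ?_)
    rw [logCutoff_eq_zero hn hx]
    exact logCutoff_nonneg n y

lemma norm_gradient_logCutoff_le {n j : ℕ} (hn : 1 ≤ n) (hj : 1 ≤ j) {x : Em m}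
    (hx : 2 ^ j ≤ ‖x‖) : ‖gradient (logCutoff m n) x‖ / (1 / n) ≤ 4 * (2 ^ j)⁻¹ := by
  have hn0 : (0 : ℝ) < n := by exact_mod_cast hn
  have hl2 : 0 < Real.log 2 := Real.log_pos (by norm_num)
  obtain ⟨i, rfl⟩ : ∃ i, j = i + 1 := ⟨j - 1, by omega⟩
  have ha : (1 : ℝ) ≤ 2 ^ i := one_le_pow₀ (by norm_num)
  have hlt : 2 ^ i < ‖x‖ := lt_of_lt_of_le (by rw [pow_succ]; linarith) hx
  have hmax : ∀ y : Em m, 2 ^ i < ‖y‖ → max ‖y‖ 1 = max ‖y‖ (2 ^ i) := fun y hy => by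
    rw [max_eq_left (by linarith), max_eq_left hy.le]
  have h1 : ‖gradient (logCutoff m n) x‖ ≤ (n * Real.log 2)⁻¹ * (2 ^ i)⁻¹ := by
    rw [norm_gradient]
    refine norm_fderiv_le_of_lip' ℝ (by positivity) ?_
    filter_upwards [continuous_norm.continuousAt.eventually_const_lt hlt] with y hy
    exact abs_logCutoff_sub_le n ha (hmax y hy) (hmax x hlt)
  have hl : (1 : ℝ) / 2 ≤ Real.log 2 := by linarith [Real.log_two_gt_d9]
  have h2 : (Real.log 2)⁻¹ ≤ 2 := by
    rw [inv_le_comm₀ hl2 (by norm_num)]; linarith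
  calc ‖gradient (logCutoff m n) x‖ / (1 / n) ≤ (n * Real.log 2)⁻¹ * (2 ^ i)⁻¹ / (1 / n) := by
        gcongr
    _ = (Real.log 2)⁻¹ * (2 ^ i)⁻¹ := by field_simp
    _ ≤ 2 * (2 ^ i)⁻¹ := by gcongr
    _ = _ := by rw [pow_succ]; field_simp; norm_num

lemma dyadic_exponent_bound {α p C C₀ d : ℝ} (hC : 0 < C) (hC₀ : 0 < C₀) (hp : 0 < p)
    (hd : 0 < d) {n j : ℕ} (hn : 1 ≤ n) (hnj : n ≤ j) (hj : j ≤ 2 * n) (hε : 1 / (n : ℝ) / d ≤ 1) :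
    (4 * (2 ^ j : ℝ)⁻¹) ^ (α - p * (1 / n / d)) *
        (C * ((2 : ℝ) ^ (j + 1)) ^ (α + C₀ * (1 / n / d)) * (Real.log (2 ^ (j + 1)))⁻¹) ≤
      2 * C * 2 ^ (3 * α + C₀ + 2 * (p + C₀) / d) / n := by
  have hn0 : (0 : ℝ) < n := by exact_mod_cast hn
  set ε := 1 / (n : ℝ) / d with hεd
  have hε0 : 0 < ε := by positivity
  have e1 : (4 * (2 ^ j : ℝ)⁻¹) = 2 ^ (2 - (j : ℝ)) := by
    rw [Real.rpow_sub two_pos, Real.rpow_natCast, div_eq_mul_inv]; norm_num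
  have e2 : (2 : ℝ) ^ (j + 1) = 2 ^ ((j : ℝ) + 1) := by
    rw [← Real.rpow_natCast]; push_cast; rfl
  have hl : (Real.log (2 ^ (j + 1)))⁻¹ ≤ 2 / n := by
    have h1 : (1 : ℝ) / 2 ≤ Real.log 2 := by linarith [Real.log_two_gt_d9]
    have h2 : (n : ℝ) ≤ j := by exact_mod_cast hnj
    rw [Real.log_pow, inv_le_comm₀ (by positivity) (by positivity), inv_div]
    push_cast
    nlinarith
  rw [e1, ← Real.rpow_mul zero_le_two]
  have hexp : (2 - (j : ℝ)) * (α - p * ε) + ((j : ℝ) + 1) * (α + C₀ * ε) ≤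
      3 * α + C₀ + 2 * (p + C₀) / d := by
    have hjε : (j : ℝ) * ε ≤ 2 / d := by
      have : (j : ℝ) ≤ 2 * n := by exact_mod_cast hj
      calc (j : ℝ) * ε ≤ 2 * n * ε := by gcongr
        _ = 2 / d := by rw [hεd]; field_simp
    have h3 : (p + C₀) * (j * ε) ≤ (p + C₀) * (2 / d) := by gcongr
    have h4 : C₀ * ε ≤ C₀ * 1 := by gcongr
    have h5 : 0 < p * ε := by positivity
    have h6 : 2 * (p + C₀) / d = (p + C₀) * (2 / d) := by ring
    rw [h6]; nlinarith
  calc _ ≤ (2 : ℝ) ^ ((2 - (j : ℝ)) * (α - p * ε)) *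
        (C * ((2 : ℝ) ^ (j + 1)) ^ (α + C₀ * ε) * (2 / n)) := by gcongr
    _ = 2 * C * (2 : ℝ) ^ ((2 - (j : ℝ)) * (α - p * ε) + ((j : ℝ) + 1) * (α + C₀ * ε)) / n := by
      rw [e2, ← Real.rpow_mul zero_le_two, Real.rpow_add two_pos]; ring
    _ ≤ _ := by
      gcongr
      norm_num

lemma lintegral_cutoff_le {p σ C C₀ R₀ ε₀ : ℝ} (hp : 2 ≤ p) (hσ : p - 1 < σ) (hC : 0 < C)
    (hC₀ : 0 < C₀) {V : Em m → ℝ} (hVpos : ∀ᵐ x : Em m, 0 < V x)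
    (hHP : ∀ ε ∈ Set.Ioo (0 : ℝ) ε₀, ∀ R > R₀,
      (∫⁻ x in Metric.ball (0 : Em m) R \ Metric.ball (0 : Em m) (R / 2),
        ENNReal.ofReal (V x ^ (-(betaC p σ) + ε))) ≤
          ENNReal.ofReal (C * R ^ (alphaC p σ + C₀ * ε) * (Real.log R)⁻¹))
    {n : ℕ} (hn : 1 ≤ n) (hR : R₀ < 2 ^ n) (hε : 1 / (n : ℝ) / (σ - p + 1) < ε₀)
    (hε1 : 1 / (n : ℝ) / (σ - p + 1) ≤ 1) :
    (∫⁻ x, ENNReal.ofReal (V x ^ (-(betaC p σ) + 1 / (n : ℝ) / (σ - p + 1)) *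
      (‖gradient (logCutoff m n) x‖ / (1 / (n : ℝ))) ^
        (alphaC p σ - p * (1 / (n : ℝ) / (σ - p + 1))))) ≤
      ENNReal.ofReal (2 * C * 2 ^ (3 * alphaC p σ + C₀ + 2 * (p + C₀) / (σ - p + 1))) := by
  have hd : 0 < σ - p + 1 := by linarith
  have hn0 : (0 : ℝ) < n := by exact_mod_cast hn
  have hα := lt_alphaC hp hσ
  set ε := 1 / (n : ℝ) / (σ - p + 1) with hεd
  have hε0 : 0 < ε := by positivity
  have ha : 0 < alphaC p σ - p * ε := by nlinarith
  set a := alphaC p σ - p * ε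
  set M := 2 * C * (2 : ℝ) ^ (3 * alphaC p σ + C₀ + 2 * (p + C₀) / (σ - p + 1)) with hM
  have hM0 : 0 < M := by positivity
  set H : Em m → ℝ≥0∞ := fun x => ENNReal.ofReal (V x ^ (-(betaC p σ) + ε) *
      (‖gradient (logCutoff m n) x‖ / (1 / (n : ℝ))) ^ a) with hH
  let S : Fin n → Set (Em m) := fun i =>
    ball (0 : Em m) (2 ^ (n + i + 1 : ℕ)) \ ball (0 : Em m) (2 ^ (n + i + 1 : ℕ) / 2)
  have hhalf : ∀ j : ℕ, (2 : ℝ) ^ (j + 1) / 2 = 2 ^ j := fun j => by rw [pow_succ]; ring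
  have hsupp : Function.support H ⊆ ⋃ i, S i := by
    intro x hx
    have hx1 : ¬ (‖x‖ < 2 ^ n ∨ 2 ^ (2 * n) ≤ ‖x‖) := fun h => hx (by
      simp [hH, gradient_logCutoff_eq_zero hn h, Real.zero_rpow ha.ne'])
    push Not at hx1
    obtain ⟨hx1, hx2⟩ := hx1
    have h1x : (1 : ℝ) ≤ ‖x‖ := (one_le_pow₀ (by norm_num)).trans hx1
    obtain ⟨j, hj1, hj2⟩ := exists_nat_pow_near h1x (one_lt_two (α := ℝ))
    have hnj : n ≤ j := by
      have : (2 : ℝ) ^ n < 2 ^ (j + 1) := hx1.trans_lt hj2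
      have := (pow_lt_pow_iff_right₀ (one_lt_two (α := ℝ))).1 this
      omega
    have hjn : j < 2 * n :=
      (pow_lt_pow_iff_right₀ (one_lt_two (α := ℝ))).1 (hj1.trans_lt hx2)
    refine mem_iUnion.2 ⟨⟨j - n, by omega⟩, ?_⟩
    have e : n + (j - n) = j := by omega
    simp only [S, e, hhalf, Set.mem_sdiff, mem_ball_zero_iff, not_lt]
    exact ⟨hj2, hj1⟩
  have hpiece : ∀ i, ∫⁻ x in S i, H x ≤ ENNReal.ofReal (M / n) := by
    intro i
    have hi := i.2
    have hmeas : MeasurableSet (S i) := measurableSet_ball.diff measurableSet_ball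
    have hle : ∫⁻ x in S i, H x ≤ ∫⁻ x in S i,
        ENNReal.ofReal ((4 * (2 ^ (n + i : ℕ) : ℝ)⁻¹) ^ a) *
          ENNReal.ofReal (V x ^ (-(betaC p σ) + ε)) := by
      refine setLIntegral_mono_ae' hmeas ?_
      filter_upwards [hVpos] with x hVx hx
      simp only [S, hhalf, Set.mem_sdiff, mem_ball_zero_iff, not_lt] at hx
      rw [← ENNReal.ofReal_mul (by positivity), mul_comm]
      refine ENNReal.ofReal_le_ofReal ?_
      gcongr
      exact norm_gradient_logCutoff_le hn (by omega) hx.2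
    refine hle.trans ?_
    rw [lintegral_const_mul' _ _ ENNReal.ofReal_ne_top]
    have hR' : (2 : ℝ) ^ (n + i + 1 : ℕ) > R₀ :=
      hR.trans_le (pow_le_pow_right₀ (by norm_num) (by omega))
    refine (mul_le_mul_right (hHP ε ⟨hε0, hε⟩ _ hR') _).trans ?_
    rw [← ENNReal.ofReal_mul (by positivity)]
    exact ENNReal.ofReal_le_ofReal (dyadic_exponent_bound hC hC₀ (by linarith) hd hn (by omega)
      (by omega) hε1)
  calc ∫⁻ x, H x = ∫⁻ x in ⋃ i, S i, H x := (setLIntegral_eq_of_support_subset hsupp).symm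
    _ ≤ ∑' i, ∫⁻ x in S i, H x := lintegral_iUnion_le _ _
    _ ≤ ∑' _ : Fin n, ENNReal.ofReal (M / n) := ENNReal.tsum_le_tsum hpiece
    _ = ENNReal.ofReal M := by
      rw [tsum_fintype, Finset.sum_const, Finset.card_univ, Fintype.card_fin, nsmul_eq_mul,
        ← ENNReal.ofReal_natCast, ← ENNReal.ofReal_mul hn0.le]
      congr 1
      field_simp

end Euclidean

theorem global_integral_bound_HP1 (p σ : ℝ) (hp : 2 ≤ p) (hσ : p - 1 < σ)
    (C C₀ R₀ ε₀ : ℝ) (hC : 0 < C) (hC₀ : 0 < C₀) (hR₀ : 0 < R₀) (hε₀ : 0 < ε₀) :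
    ∃ C' > (0 : ℝ), ∀ m : ℕ, 1 ≤ m →
      ∀ V : Em m → ℝ, LocallyIntegrable V volume → (∀ᵐ x : Em m, 0 < V x) →
        (∀ ε ∈ Set.Ioo (0 : ℝ) ε₀, ∀ R > R₀,
          (∫⁻ x in Metric.ball (0 : Em m) R \ Metric.ball (0 : Em m) (R / 2),
              ENNReal.ofReal (V x ^ (-(betaC p σ) + ε))) ≤
            ENNReal.ofReal (C * R ^ (alphaC p σ + C₀ * ε) * (Real.log R)⁻¹)) →
        ∀ u : Em m → ℝ, IsWeakSol p σ V u → IsStable p σ V u →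
          (∫⁻ x, ENNReal.ofReal (V x * |u x| ^ (σ + gammaBar p σ))) ≤
              ENNReal.ofReal C' ∧
            Integrable (fun x => V x * |u x| ^ (σ + gammaBar p σ)) := by
  obtain ⟨K, hK, δ₁, hδ₁, -, hδ₁g, k, hest⟩ := stable_integral_estimate hp hσ
  have hd : 0 < σ - p + 1 := by linarith
  have hg := one_lt_gammaBar hp hσ
  set M := 2 * C * (2 : ℝ) ^ (3 * alphaC p σ + C₀ + 2 * (p + C₀) / (σ - p + 1)) with hM
  have hM0 : 0 < M := by positivity
  refine ⟨K * M, by positivity, ?_⟩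
  intro m _ V hV hVpos hHP u hu hst
  have hVm : AEMeasurable V volume := hV.aestronglyMeasurable.aemeasurable
  have hinv : Tendsto (fun n : ℕ => 1 / (n : ℝ)) atTop (nhds 0) :=
    tendsto_one_div_atTop_nhds_zero_nat
  have hinv' : Tendsto (fun n : ℕ => 1 / (n : ℝ) / (σ - p + 1)) atTop (nhds 0) := by
    simpa using hinv.div_const (σ - p + 1)
  let f : ℕ → Em m → ℝ≥0∞ := fun n => (ball (0 : Em m) (2 ^ n)).indicator fun x =>
    ENNReal.ofReal (V x * |u x| ^ (σ + (gammaBar p σ - 1 / n)))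
  have hbound : ∀ᶠ n in atTop, ∫⁻ x, f n x ≤ ENNReal.ofReal (K * M) := by
    filter_upwards [eventually_ge_atTop 1, hinv.eventually_lt_const hδ₁,
      hinv'.eventually_lt_const hε₀, hinv'.eventually_le_const one_pos,
      (tendsto_pow_atTop_atTop_of_one_lt (one_lt_two (α := ℝ))).eventually_gt_atTop R₀]
      with n hn hδ hε hε1 hR
    have hn0 : (0 : ℝ) < n := by exact_mod_cast hn
    calc ∫⁻ x, f n x ≤ ∫⁻ x, ENNReal.ofReal (V x * |u x| ^ (σ + (gammaBar p σ - 1 / n)) *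
          logCutoff m n x ^ (2 * k)) := by
          refine lintegral_mono fun x => ?_
          simp only [f]
          by_cases hx : x ∈ ball (0 : Em m) (2 ^ n)
          · rw [indicator_of_mem hx, logCutoff_eq_one hn (mem_ball_zero_iff.1 hx).le, one_pow,
              mul_one]
          · rw [indicator_of_notMem hx]
            exact bot_le
      _ ≤ _ := hest (1 / n) (by positivity) hδ m V hV hVpos u hu hst _ (lipCS_logCutoff hn)
          (logCutoff_nonneg n) (logCutoff_le_one n)
      _ ≤ ENNReal.ofReal K * ENNReal.ofReal M := by
          gcongr
          exact lintegral_cutoff_le hp hσ hC hC₀ hVpos hHP hn hR hε hε1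
      _ = _ := (ENNReal.ofReal_mul hK.le).symm
  have hlim : ∀ x, Tendsto (fun n => f n x) atTop
      (nhds (ENNReal.ofReal (V x * |u x| ^ (σ + gammaBar p σ)))) := by
    intro x
    have hexp : Tendsto (fun n : ℕ => σ + (gammaBar p σ - 1 / (n : ℝ))) atTop
        (nhds (σ + gammaBar p σ)) := by
      simpa using (hinv.const_sub (gammaBar p σ)).const_add σ
    have hpow : ContinuousAt (fun s : ℝ => |u x| ^ s) (σ + gammaBar p σ) :=
      Real.continuousAt_const_rpow' (by linarith)
    refine ((ENNReal.tendsto_ofReal ((hpow.tendsto.comp hexp).const_mul (V x)))).congr' ?_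
    filter_upwards [(tendsto_pow_atTop_atTop_of_one_lt (one_lt_two (α := ℝ))).eventually_gt_atTop
      ‖x‖] with n hn
    simp only [f, Function.comp_apply]
    rw [indicator_of_mem (mem_ball_zero_iff.2 hn)]
  have hle : (∫⁻ x, ENNReal.ofReal (V x * |u x| ^ (σ + gammaBar p σ))) ≤
      ENNReal.ofReal (K * M) := by
    calc ∫⁻ x, ENNReal.ofReal (V x * |u x| ^ (σ + gammaBar p σ))
        = ∫⁻ x, liminf (fun n => f n x) atTop :=
          lintegral_congr fun x => (hlim x).liminf_eq.symm
      _ ≤ liminf (fun n => ∫⁻ x, f n x) atTop := lintegral_liminf_le' fun n =>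
          (hVm.mul (hu.1.continuous.abs.measurable.pow_const _).aemeasurable).ennreal_ofReal
            |>.indicator measurableSet_ball
      _ ≤ _ := liminf_le_of_frequently_le' hbound.frequently
  refine ⟨hle,
    (lintegral_ofReal_ne_top_iff_integrable ?_ ?_).1 (hle.trans_lt ENNReal.ofReal_lt_top).ne⟩
  · exact (hVm.mul (hu.1.continuous.abs.measurable.pow_const _).aemeasurable).aestronglyMeasurable
  · filter_upwards [hVpos] with x hx
    simp only [Pi.zero_apply]; positivity
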